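/- arXiv:1606.09623 — 2 statements merged into one kernel-verified Lean document; each statement's English description precedes it below -/
import Mathlib

section
/- For all integers ℓ_1, …, ℓ_r, k, n ≥ 0 one has D̄(ℓ_1,…,ℓ_r;k,n) = Ē(ℓ_1,…,ℓ_r;k,n). -/
namespace Stmt0

/-- A coloured part: (size, colour, overlined?).  Colours are indexed by
`j ∈ {1, …, 2^r - 1}`, the colour `ũ_j` containing the primary colour `u_{k+1}`
iff the binary digit `2^k` appears in `j`. -/
abbrev CPart : Type := ℕ × ℕ × Bool

/-- Total order used to list the parts canonically: size first, then colour,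
and among parts of equal size and colour the overlined one comes first. -/
def COrder (p q : CPart) : Prop :=
  q.1 < p.1 ∨ (p.1 = q.1 ∧
    (q.2.1 < p.2.1 ∨ (p.2.1 = q.2.1 ∧ (p.2.2 = true ∨ q.2.2 = false))))

/-- At most one overlined part of each given size and colour. -/
def NoDupOverlined (L : List CPart) : Prop :=
  L.Pairwise (fun p q => p.2.2 = true → q.2.2 = true → ¬(p.1 = q.1 ∧ p.2.1 = q.2.1))

/-- A coloured overpartition (listed canonically). -/
def IsColouredOverpartition (L : List CPart) : Prop :=
  List.Chain' COrder L ∧ NoDupOverlined L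

/-- `w`: the number of primary colours of the colour `c` (number of binary ones). -/
def w (c : ℕ) : ℕ := (Nat.digits 2 c).sum

/-- index (0-based) of the smallest primary colour appearing in `c`. -/
noncomputable def v (c : ℕ) : ℕ := sInf {k : ℕ | c.testBit k = true}

/-- index (0-based) of the largest primary colour appearing in `c`. -/
noncomputable def z (c : ℕ) : ℕ := sSup {k : ℕ | c.testBit k = true}

/-- `δ(c, c') = 1` if `z c < v c'` and `0` otherwise. -/
noncomputable def delta (c c' : ℕ) : ℕ := if z c < v c' then 1 else 0

def chi (b : Bool) : ℕ := if b then 1 else 0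

/-- The difference condition
`λ_i - λ_{i+1} ≥ w(c(λ_{i+1})) + χ(overlined λ_{i+1}) - 1 + δ(c(λ_i), c(λ_{i+1}))`. -/
noncomputable def DiffCond (p q : CPart) : Prop :=
  (w q.2.1 : ℤ) + chi q.2.2 - 1 + delta p.2.1 q.2.1 ≤ (p.1 : ℤ) - q.1

/-- `D̄(ℓ_1,…,ℓ_r;k,n)`: number of coloured overpartitions of `n` into
non-negative parts with primary colours, `ℓ i` parts of colour `u_{i+1}`
and `k` non-overlined parts. -/
noncomputable def Dbar (r : ℕ) (ℓ : Fin r → ℕ) (k n : ℕ) : ℕ :=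
  Nat.card {L : List CPart //
    IsColouredOverpartition L ∧
    (L.map Prod.fst).sum = n ∧
    (∀ p ∈ L, ∃ i : Fin r, p.2.1 = 2 ^ (i : ℕ)) ∧
    (∀ i : Fin r, L.countP (fun p => p.2.1 == 2 ^ (i : ℕ)) = ℓ i) ∧
    L.countP (fun p => !p.2.2) = k}

/-- `Ē(ℓ_1,…,ℓ_r;k,n)`: number of coloured overpartitions of `n` into
non-negative parts with colours among `ũ_1, …, ũ_{2^r-1}`, with `ℓ i` parts
having `u_{i+1}` among their primary colours, `k` non-overlined parts and
satisfying the difference conditions. -/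
noncomputable def Ebar (r : ℕ) (ℓ : Fin r → ℕ) (k n : ℕ) : ℕ :=
  Nat.card {L : List CPart //
    IsColouredOverpartition L ∧
    (L.map Prod.fst).sum = n ∧
    (∀ p ∈ L, 1 ≤ p.2.1 ∧ p.2.1 ≤ 2 ^ r - 1) ∧
    (∀ i : Fin r, L.countP (fun p => p.2.1.testBit (i : ℕ)) = ℓ i) ∧
    L.countP (fun p => !p.2.2) = k ∧
    List.Chain' DiffCond L}

/-- A primary letter of a partition whose parts have been spelled out from left to right, each
block of letters in increasing order.  The last letter of a block carries the size of the part and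
its overline; the other letters of the block carry `none`. -/
abbrev Entry : Type := ℕ × Option (ℕ × Bool)

/-- `1` if `y < y₁`, and `0` otherwise. -/
def up (y y₁ : ℕ) : ℕ := if y < y₁ then 1 else 0

/-- `1` if the letter `y` forms an ascent with the first letter of `L`, and `0` otherwise. -/
def asc (y : ℕ) : List Entry → ℕ
  | [] => 0
  | e :: _ => up y e.1

/-- The lower bound that the first block of `L` imposes on the size of a preceding part,
up to the ascent contribution. -/
def need : List Entry → ℕ
  | [] => 0
  | (_, some (m, b)) :: _ => m + chi b
  | (y, none) :: L => need L + asc y L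

/-- The spelled-out form of the difference conditions. -/
def Valid : List Entry → Prop
  | [] => True
  | (y, some (m, _)) :: L => need L + asc y L ≤ m ∧ Valid L
  | (y, none) :: L => asc y L = 1 ∧ Valid L

/-- Insertion of an overlined part of size `a` with letter `y`. -/
def ins (y a : ℕ) : List Entry → List Entry
  | [] => [(y, some (a, true))]
  | (y₁, none) :: L => (y, none) :: (y₁, none) :: L
  | (y₁, some (m, b)) :: L =>
    if m + chi b + up y y₁ ≤ a then (y, some (a, true)) :: (y₁, some (m, b)) :: L
    else if a < up y y₁ then (y, none) :: (y₁, some (m, b)) :: L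
    else (y, some (m + up y y₁, b)) :: ins y₁ (a - up y y₁) L

/-- The size of the overlined part inserted last, if there is any. -/
def key : List Entry → Option ℕ
  | [] => none
  | (_, none) :: _ => some 0
  | (y, some (m, b)) :: L =>
    match key L with
    | some k => some (k + asc y L)
    | none => if b then some m else none

/-- Removal of the overlined part inserted last. -/
def rest : List Entry → List Entry
  | [] => []
  | (_, none) :: L => L
  | (y, some (m, b)) :: L =>
    match key L with
    | some _ => ((L.map Prod.fst).headD 0, some (m - asc y L, b)) :: rest L
    | none => L

/-- The condition under which the part of size `a` with letter `y` may be inserted into `L`. -/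
def Adm (y a : ℕ) (L : List Entry) : Prop :=
  ∀ k, key L = some k → a < k + asc y L

theorem up_le_one (y y₁ : ℕ) : up y y₁ ≤ 1 := by
  unfold up
  split_ifs <;> omega

theorem asc_cons (y y₁ : ℕ) (o : Option (ℕ × Bool)) (L : List Entry) :
    asc y ((y₁, o) :: L) = up y y₁ := rfl

theorem key_le_need {L : List Entry} (hL : Valid L) {k : ℕ} (hk : key L = some k) :
    k ≤ need L := by
  induction L generalizing k with
  | nil => simp [key] at hk
  | cons e L ih =>
    obtain ⟨y, _ | ⟨m, b⟩⟩ := e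
    · simp only [key, Option.some.injEq] at hk
      omega
    · simp only [Valid] at hL
      simp only [key, need] at hk ⊢
      rcases hkL : key L with _ | k'
      · rw [hkL] at hk
        simp only [Option.ite_none_right_eq_some, Option.some.injEq] at hk
        omega
      · rw [hkL] at hk
        simp only [Option.some.injEq] at hk
        have := ih hL.2 hkL
        omega

theorem ins_eq_cons (y a : ℕ) (L : List Entry) : ∃ o L', ins y a L = (y, o) :: L' := by
  rcases L with _ | ⟨⟨y₁, _ | ⟨m, b⟩⟩, L⟩ <;> simp only [ins] <;> (try split_ifs) <;>
    exact ⟨_, _, rfl⟩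

theorem asc_ins (z y a : ℕ) (L : List Entry) : asc z (ins y a L) = up z y := by
  obtain ⟨o, L', h⟩ := ins_eq_cons y a L
  rw [h]
  rfl

theorem headD_ins (y a : ℕ) (L : List Entry) : ((ins y a L).map Prod.fst).headD 0 = y := by
  obtain ⟨o, L', h⟩ := ins_eq_cons y a L
  simp [h]

theorem Adm.of_none {y a y₁ : ℕ} {L : List Entry} (h : Adm y a ((y₁, none) :: L)) :
    a = 0 ∧ up y y₁ = 1 := by
  have h1 := h 0 rfl
  rw [asc_cons] at h1
  have := up_le_one y y₁
  omega

theorem Adm.tail {y a y₁ m : ℕ} {b : Bool} {L : List Entry}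
    (h : Adm y a ((y₁, some (m, b)) :: L)) (ha : up y y₁ ≤ a) :
    Adm y₁ (a - up y y₁) L := by
  intro k hk
  have h1 := h (k + asc y₁ L) (by simp [key, hk])
  rw [asc_cons] at h1
  omega

theorem need_ins {y a : ℕ} {L : List Entry} (h : Adm y a L) :
    need (ins y a L) = max (a + 1) (need L + asc y L) := by
  rcases L with _ | ⟨⟨y₁, _ | ⟨m, b⟩⟩, L⟩
  · simp [ins, need, asc, chi]
  · obtain ⟨rfl, h1⟩ := h.of_none
    simp only [ins, need, asc_cons y, h1]
    omega
  · have := up_le_one y y₁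
    simp only [ins, asc_cons y]
    split_ifs with h1 h2 <;> simp only [need, chi, asc_cons y] at * <;> grind

theorem ins_spec {L : List Entry} (hL : Valid L) {y a : ℕ} (h : Adm y a L) :
    Valid (ins y a L) ∧ key (ins y a L) = some a ∧ rest (ins y a L) = L := by
  induction L generalizing y a with
  | nil => simp [ins, Valid, key, rest, need, asc]
  | cons e L ih =>
    obtain ⟨y₁, _ | ⟨m, b⟩⟩ := e
    · obtain ⟨rfl, h1⟩ := h.of_none
      simp only [ins, Valid, key, rest, asc_cons y, h1] at hL ⊢
      simpa using hL
    · have hδ := up_le_one y y₁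
      simp only [ins]
      split_ifs with h1 h2
      · have hk : key ((y₁, some (m, b)) :: L) = none := by
          rcases hk : key ((y₁, some (m, b)) :: L) with _ | k
          · rfl
          · have h3 := h k hk
            have h4 := key_le_need hL hk
            rw [asc_cons] at h3
            simp only [need] at h3 h4
            omega
        refine ⟨⟨?_, hL⟩, ?_, ?_⟩
        · simpa only [need, asc_cons y] using h1
        · simp [key.eq_3 y, hk]
        · simp [rest.eq_3 y, hk]
      · refine ⟨⟨?_, hL⟩, ?_, rfl⟩
        · rw [asc_cons]; omega
        · simp only [key, Option.some.injEq]; omega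
      · have hA := h.tail (not_lt.1 h2)
        obtain ⟨i1, i2, i3⟩ := ih hL.2 hA
        have hv := hL.1
        have hm : a - up y y₁ < m := by
          rcases hk : key L with _ | k
          · cases b
            · simp only [chi] at h1
              grind
            · have h3 := h m (by simp [key, hk])
              rw [asc_cons] at h3
              omega
          · have h3 := key_le_need hL.2 hk
            have h4 := hA k hk
            omega
        refine ⟨⟨?_, i1⟩, ?_, ?_⟩
        · rw [asc_ins, need_ins hA]
          omega
        · simp only [key, i2, asc_ins, Option.some.injEq]
          omega
        · simp only [rest, i2, asc_ins, i3, headD_ins, Nat.add_sub_cancel]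

theorem rest_spec {L : List Entry} (hL : Valid L) {a : ℕ} (ha : key L = some a) :
    Valid (rest L) ∧ ∃ y, Adm y a (rest L) ∧ ins y a (rest L) = L := by
  induction L generalizing a with
  | nil => simp [key] at ha
  | cons e L ih =>
    obtain ⟨y, _ | ⟨m, b⟩⟩ := e
    · simp only [key, Option.some.injEq] at ha
      subst ha
      obtain ⟨h1, h2⟩ := hL
      refine ⟨h2, y, fun k _ => by simp only [rest]; omega, ?_⟩
      rcases L with _ | ⟨⟨y₁, _ | ⟨m, b⟩⟩, L⟩
      · simp [asc] at h1
      · rfl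
      · rw [asc_cons] at h1
        simp [rest, ins, h1]
    · obtain ⟨h1, h2⟩ := hL
      rcases hk : key L with _ | k
      · simp only [key, hk, Option.ite_none_right_eq_some, Option.some.injEq] at ha
        obtain ⟨rfl, rfl⟩ := ha
        simp only [rest, hk]
        refine ⟨h2, y, fun k hk' => by simp [hk] at hk', ?_⟩
        rcases L with _ | ⟨⟨y₁, _ | ⟨m', b⟩⟩, L⟩
        · rfl
        · simp [key] at hk
        · rw [asc_cons] at h1
          simp only [need] at h1
          simp only [ins, if_pos h1]
      · simp only [key, hk, Option.some.injEq] at ha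
        obtain ⟨i1, y₁, i2, i3⟩ := ih h2 hk
        have hn := need_ins i2
        have hasc := asc_ins y y₁ k (rest L)
        have hhead := headD_ins y₁ k (rest L)
        rw [i3] at hn hasc hhead
        simp only [rest, hk, hhead]
        rw [hasc] at ha h1 ⊢
        have hδ := up_le_one y y₁
        refine ⟨⟨by omega, i1⟩, y, ?_, ?_⟩
        · intro k' hk'
          rw [asc_cons]
          rcases hr : key (rest L) with _ | k''
          · simp only [key, hr, Option.ite_none_right_eq_some, Option.some.injEq] at hk'
            omega
          · simp only [key, hr, Option.some.injEq] at hk'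
            have := i2 _ hr
            omega
        · simp only [ins]
          rw [if_neg (by omega), if_neg (by omega), ← ha, Nat.add_sub_cancel, i3,
            Nat.sub_add_cancel (by omega)]

/-- The order in which overlined parts (letter, size) are inserted, the last one first. -/
def Before (p q : ℕ × ℕ) : Prop := p.2 < q.2 + up p.1 q.1

/-- The order of the non-overlined parts (letter, size). -/
def After (p q : ℕ × ℕ) : Prop := q.2 + up p.1 q.1 ≤ p.2

/-- A non-overlined part (letter, size) as an entry. -/
def plain (p : ℕ × ℕ) : Entry := (p.1, some (p.2, false))

/-- Insertion of the overlined parts `A` into the list `B` of non-overlined parts. -/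
def build (A B : List (ℕ × ℕ)) : List Entry :=
  A.foldr (fun p => ins p.1 p.2) (B.map plain)

/-- The contribution of an entry to the sum of the parts. -/
def esize (e : Entry) : ℕ := (e.2.map Prod.fst).getD 0

/-- Whether the entry carries a non-overlined part. -/
def isPlain (e : Entry) : Bool := (e.2.map fun x => !x.2).getD false

theorem map_fst_ins (y a : ℕ) (L : List Entry) :
    (ins y a L).map Prod.fst = y :: L.map Prod.fst := by
  induction L generalizing y a with
  | nil => rfl
  | cons e L ih =>
    obtain ⟨y₁, _ | ⟨m, b⟩⟩ := e
    · rfl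
    · simp only [ins]
      split_ifs <;> simp [ih]

theorem sum_esize_ins {y a : ℕ} {L : List Entry} (h : Adm y a L) :
    ((ins y a L).map esize).sum = a + (L.map esize).sum := by
  induction L generalizing y a with
  | nil => simp [ins, esize]
  | cons e L ih =>
    obtain ⟨y₁, _ | ⟨m, b⟩⟩ := e
    · obtain ⟨rfl, -⟩ := h.of_none
      simp [ins, esize]
    · have hδ := up_le_one y y₁
      simp only [ins]
      split_ifs with h1 h2
      · simp [esize]
      · simp only [List.map_cons, List.sum_cons, esize, Option.map_none, Option.map_some,
          Option.getD_none, Option.getD_some]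
        omega
      · simp only [List.map_cons, List.sum_cons, ih (h.tail (not_lt.1 h2)), esize,
          Option.map_some, Option.getD_some]
        omega

theorem countP_isPlain_ins (y a : ℕ) (L : List Entry) :
    (ins y a L).countP isPlain = L.countP isPlain := by
  induction L generalizing y a with
  | nil => rfl
  | cons e L ih =>
    obtain ⟨y₁, _ | ⟨m, b⟩⟩ := e
    · simp [ins, isPlain]
    · simp only [ins]
      split_ifs <;> simp [List.countP_cons, isPlain, ih]

theorem valid_map_plain (B : List (ℕ × ℕ)) : Valid (B.map plain) ↔ B.IsChain After := by
  induction B with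
  | nil => simp [Valid]
  | cons p B ih =>
    rcases B with _ | ⟨q, B⟩
    · simp [Valid, plain, need, asc]
    · rw [List.isChain_cons_cons, ← ih]
      simp [Valid, plain, need, asc, After, chi]

theorem key_map_plain (B : List (ℕ × ℕ)) : key (B.map plain) = none := by
  induction B with
  | nil => rfl
  | cons p B ih => simp [key, plain, ih]

theorem exists_map_plain {L : List Entry} (h : key L = none) :
    ∃ B : List (ℕ × ℕ), B.map plain = L := by
  induction L with
  | nil => exact ⟨[], rfl⟩
  | cons e L ih =>
    obtain ⟨y, _ | ⟨m, b⟩⟩ := e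
    · simp [key] at h
    · rcases hk : key L with _ | k
      · obtain ⟨B, rfl⟩ := ih hk
        simp only [key, hk, ite_eq_right_iff, reduceCtorEq, imp_false, Bool.not_eq_true] at h
        subst h
        exact ⟨(y, m) :: B, rfl⟩
      · simp [key, hk] at h

theorem plain_injective : Function.Injective plain := by
  rintro ⟨y, m⟩ ⟨y', m'⟩ h
  simpa [plain] using h

theorem build_cons (p : ℕ × ℕ) (A B : List (ℕ × ℕ)) :
    build (p :: A) B = ins p.1 p.2 (build A B) := rfl

theorem adm_build {p : ℕ × ℕ} {A B : List (ℕ × ℕ)} (hA : (p :: A).IsChain Before)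
    (hB : B.IsChain After) : Valid (build A B) ∧ Adm p.1 p.2 (build A B) := by
  induction A generalizing p with
  | nil =>
    refine ⟨(valid_map_plain B).2 hB, fun k hk => ?_⟩
    simp [build, key_map_plain] at hk
  | cons q A ih =>
    obtain ⟨h1, h2⟩ := List.isChain_cons_cons.1 hA
    obtain ⟨i1, i2⟩ := ih h2
    obtain ⟨j1, j2, -⟩ := ins_spec i1 i2
    refine ⟨j1, fun k hk => ?_⟩
    rw [build_cons] at hk ⊢
    rw [j2, Option.some.injEq] at hk
    rw [asc_ins, ← hk]
    exact h1

theorem valid_build {A B : List (ℕ × ℕ)} (hA : A.IsChain Before) (hB : B.IsChain After) :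
    Valid (build A B) := by
  rcases A with _ | ⟨p, A⟩
  · exact (valid_map_plain B).2 hB
  · obtain ⟨h1, h2⟩ := adm_build hA hB
    exact (ins_spec h1 h2).1

theorem build_injective {A A' B B' : List (ℕ × ℕ)} (hA : A.IsChain Before)
    (hB : B.IsChain After) (hA' : A'.IsChain Before) (hB' : B'.IsChain After)
    (h : build A B = build A' B') : A = A' ∧ B = B' := by
  induction A generalizing A' with
  | nil =>
    rcases A' with _ | ⟨p, A'⟩
    · exact ⟨rfl, plain_injective.list_map h⟩
    · obtain ⟨h1, h2⟩ := adm_build hA' hB'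
      have h3 := (ins_spec h1 h2).2.1
      rw [← build_cons, ← h] at h3
      simp [build, key_map_plain] at h3
  | cons q A ih =>
    obtain ⟨h1, h2⟩ := adm_build hA hB
    obtain ⟨-, h3, h4⟩ := ins_spec h1 h2
    rcases A' with _ | ⟨p, A'⟩
    · rw [← build_cons, h] at h3
      simp [build, key_map_plain] at h3
    · obtain ⟨h1', h2'⟩ := adm_build hA' hB'
      obtain ⟨-, h3', h4'⟩ := ins_spec h1' h2'
      have h5 := headD_ins q.1 q.2 (build A B)
      rw [← build_cons, h] at h3 h4 h5
      rw [build_cons] at h3 h4 h5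
      rw [h3', Option.some.injEq] at h3
      rw [h4'] at h4
      rw [headD_ins] at h5
      obtain ⟨rfl, rfl⟩ := ih hA.tail hA'.tail h4.symm
      exact ⟨by rw [Prod.ext h5 h3], rfl⟩

theorem exists_build {L : List Entry} (hL : Valid L) :
    ∃ A B : List (ℕ × ℕ), A.IsChain Before ∧ B.IsChain After ∧ build A B = L := by
  induction hn : L.length generalizing L with
  | zero =>
    rw [List.length_eq_zero_iff] at hn
    exact ⟨[], [], by simp, by simp, hn.symm⟩
  | succ n ih =>
    rcases hk : key L with _ | a
    · obtain ⟨B, rfl⟩ := exists_map_plain hk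
      exact ⟨[], B, by simp, (valid_map_plain B).1 hL, rfl⟩
    · obtain ⟨h1, y, h2, h3⟩ := rest_spec hL hk
      have hlen : (rest L).length = n := by
        have := congrArg List.length h3
        have h4 := congrArg List.length (map_fst_ins y a (rest L))
        simp only [List.length_map, List.length_cons] at h4
        omega
      obtain ⟨A, B, hA, hB, h4⟩ := ih h1 hlen
      refine ⟨(y, a) :: A, B, ?_, hB, by rw [build_cons, h4, h3]⟩
      rcases A with _ | ⟨q, A⟩
      · simp
      · refine List.isChain_cons_cons.2 ⟨?_, hA⟩
        obtain ⟨i1, i2⟩ := adm_build hA hB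
        have h5 := h2 q.2 (by rw [← h4]; exact (ins_spec i1 i2).2.1)
        rw [← h4, build_cons, asc_ins] at h5
        exact h5

theorem map_fst_build (A B : List (ℕ × ℕ)) :
    (build A B).map Prod.fst = (A ++ B).map Prod.fst := by
  induction A with
  | nil => simp [build, plain, Function.comp_def]
  | cons p A ih => rw [build_cons, map_fst_ins, ih]; rfl

theorem sum_esize_build {A B : List (ℕ × ℕ)} (hA : A.IsChain Before) (hB : B.IsChain After) :
    ((build A B).map esize).sum = ((A ++ B).map Prod.snd).sum := by
  induction A with
  | nil => simp [build, plain, esize, Function.comp_def]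
  | cons p A ih =>
    rw [build_cons, sum_esize_ins (adm_build hA hB).2, ih hA.tail]
    rfl

theorem countP_isPlain_build (A B : List (ℕ × ℕ)) :
    (build A B).countP isPlain = B.length := by
  induction A with
  | nil =>
    simp [build, List.countP_map, Function.comp_def, isPlain, plain]
  | cons p A ih => rw [build_cons, countP_isPlain_ins, ih]

/-- A word in the letters `0, …, r - 1` with `ℓ i` occurrences of `i`. -/
def IsWord {r : ℕ} (ℓ : Fin r → ℕ) (u : List ℕ) : Prop :=
  (∀ y ∈ u, y < r) ∧ ∀ i : Fin r, u.count (i : ℕ) = ℓ i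

/-- The spelled-out overpartitions with prescribed statistics. -/
def entrySet {r : ℕ} (ℓ : Fin r → ℕ) (k n : ℕ) : Set (List Entry) :=
  {L | Valid L ∧ IsWord ℓ (L.map Prod.fst) ∧ (L.map esize).sum = n ∧ L.countP isPlain = k}

/-- Pairs of an ordered list of overlined parts and an ordered list of non-overlined parts
with prescribed statistics. -/
def pairSet {r : ℕ} (ℓ : Fin r → ℕ) (k n : ℕ) : Set (List (ℕ × ℕ) × List (ℕ × ℕ)) :=
  {P | P.1.IsChain Before ∧ P.2.IsChain After ∧ IsWord ℓ ((P.1 ++ P.2).map Prod.fst) ∧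
    ((P.1 ++ P.2).map Prod.snd).sum = n ∧ P.2.length = k}

theorem bijOn_build {r : ℕ} (ℓ : Fin r → ℕ) (k n : ℕ) :
    Set.BijOn (fun P => build P.1 P.2) (pairSet ℓ k n) (entrySet ℓ k n) := by
  refine ⟨?_, ?_, ?_⟩
  · rintro ⟨A, B⟩ ⟨hA, hB, hw, hn, hk⟩
    exact ⟨valid_build hA hB, by rwa [map_fst_build], by rwa [sum_esize_build hA hB],
      by rwa [countP_isPlain_build]⟩
  · rintro ⟨A, B⟩ ⟨hA, hB, -⟩ ⟨A', B'⟩ ⟨hA', hB', -⟩ h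
    obtain ⟨rfl, rfl⟩ := build_injective hA hB hA' hB' h
    rfl
  · rintro L ⟨hL, hw, hn, hk⟩
    obtain ⟨A, B, hA, hB, rfl⟩ := exists_build hL
    rw [map_fst_build] at hw
    rw [sum_esize_build hA hB] at hn
    rw [countP_isPlain_build] at hk
    exact ⟨(A, B), ⟨hA, hB, hw, hn, hk⟩, rfl⟩

theorem w_two_mul (n : ℕ) : w (2 * n) = w n := by
  rcases Nat.eq_zero_or_pos n with rfl | hn
  · rfl
  · unfold w
    rw [Nat.digits_def' (by norm_num) (by omega : 0 < 2 * n)]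
    simp

theorem w_two_mul_add_one (n : ℕ) : w (2 * n + 1) = w n + 1 := by
  unfold w
  rw [Nat.digits_def' (by norm_num) (by omega : 0 < 2 * n + 1),
    show (2 * n + 1) % 2 = 1 by omega, show (2 * n + 1) / 2 = n by omega, List.sum_cons,
    Nat.add_comm]

theorem w_two_pow_mul (y n : ℕ) : w (2 ^ y * n) = w n := by
  induction y with
  | zero => simp
  | succ y ih => rw [pow_succ', mul_assoc, w_two_mul, ih]

theorem w_two_pow (y : ℕ) : w (2 ^ y) = 1 := by
  have := w_two_pow_mul y 1
  simpa [w] using this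

theorem testBit_v {c : ℕ} (hc : c ≠ 0) : c.testBit (v c) = true :=
  Nat.sInf_mem (s := {k : ℕ | c.testBit k = true}) (Nat.exists_testBit_of_ne_zero hc)

theorem v_le {c i : ℕ} (h : c.testBit i = true) : v c ≤ i :=
  Nat.sInf_le (s := {k : ℕ | c.testBit k = true}) h

theorem v_eq {c y : ℕ} (h : c.testBit y = true) (h' : ∀ i, c.testBit i = true → y ≤ i) :
    v c = y :=
  (v_le h).antisymm (le_csInf ⟨y, h⟩ h')

theorem bddAbove_testBit (c : ℕ) : BddAbove {k : ℕ | c.testBit k = true} :=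
  ⟨c, fun _ hk => (Nat.lt_two_pow_self.trans_le (Nat.ge_two_pow_of_testBit hk)).le⟩

theorem testBit_z {c : ℕ} (hc : c ≠ 0) : c.testBit (z c) = true :=
  Nat.sSup_mem (s := {k : ℕ | c.testBit k = true}) (Nat.exists_testBit_of_ne_zero hc)
    (bddAbove_testBit c)

theorem le_z {c i : ℕ} (h : c.testBit i = true) : i ≤ z c :=
  le_csSup (bddAbove_testBit c) h

theorem z_eq {c y : ℕ} (h : c.testBit y = true) (h' : ∀ i, c.testBit i = true → i ≤ y) :
    z c = y :=
  (csSup_le' (s := {k : ℕ | c.testBit k = true}) h').antisymm (le_z h)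

theorem v_two_pow (y : ℕ) : v (2 ^ y) = y :=
  v_eq (by simp) fun i hi => by
    simp only [Nat.testBit_two_pow, decide_eq_true_eq] at hi
    exact hi.le

theorem z_two_pow (y : ℕ) : z (2 ^ y) = y :=
  z_eq (by simp) fun i hi => by
    simp only [Nat.testBit_two_pow, decide_eq_true_eq] at hi
    exact hi.ge

theorem exists_eq_two_pow_mul {c y : ℕ} (h : y < v c) : ∃ e, c = 2 ^ (y + 1) * e := by
  refine Nat.dvd_of_mod_eq_zero (Nat.eq_of_testBit_eq fun i => ?_)
  rw [Nat.testBit_mod_two_pow, Nat.zero_testBit]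
  by_contra hi
  simp only [Bool.and_eq_false_imp, not_forall, Bool.not_eq_false, decide_eq_true_eq] at hi
  obtain ⟨h1, h2⟩ := hi
  have := v_le h2
  omega

theorem w_two_pow_add {c y : ℕ} (h : y < v c) : w (2 ^ y + c) = w c + 1 := by
  obtain ⟨e, rfl⟩ := exists_eq_two_pow_mul h
  rw [show 2 ^ y + 2 ^ (y + 1) * e = 2 ^ y * (2 * e + 1) by ring, w_two_pow_mul,
    w_two_mul_add_one, w_two_pow_mul]

theorem testBit_two_pow_add {c y : ℕ} (h : y < v c) (i : ℕ) :
    (2 ^ y + c).testBit i = (decide (y = i) || c.testBit i) := by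
  obtain ⟨e, rfl⟩ := exists_eq_two_pow_mul h
  rw [Nat.add_comm, Nat.two_pow_add_eq_or_of_lt (Nat.pow_lt_pow_right (by norm_num) y.lt_succ_self),
    Nat.testBit_or, Nat.testBit_two_pow, Bool.or_comm]

theorem v_two_pow_add {c y : ℕ} (h : y < v c) : v (2 ^ y + c) = y := by
  refine v_eq (by simp [testBit_two_pow_add h]) fun i hi => ?_
  simp only [testBit_two_pow_add h, Bool.or_eq_true, decide_eq_true_eq] at hi
  rcases hi with hi | hi
  · exact hi.le
  · exact h.le.trans (v_le hi)

theorem z_two_pow_add {c y : ℕ} (hc : c ≠ 0) (h : y < v c) : z (2 ^ y + c) = z c := by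
  refine z_eq (by simp [testBit_two_pow_add h, testBit_z hc]) fun i hi => ?_
  simp only [testBit_two_pow_add h, Bool.or_eq_true, decide_eq_true_eq] at hi
  rcases hi with rfl | hi
  · exact h.le.trans (v_le (testBit_z hc))
  · exact le_z hi

theorem eq_two_pow_or {c : ℕ} (hc : c ≠ 0) :
    c = 2 ^ v c ∨ ∃ y c', c' ≠ 0 ∧ y < v c' ∧ c = 2 ^ y + c' := by
  have hle : 2 ^ v c ≤ c := Nat.ge_two_pow_of_testBit (testBit_v hc)
  rcases hle.eq_or_lt with h | h
  · exact Or.inl h.symm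
  · refine Or.inr ⟨v c, c - 2 ^ v c, by omega, ?_, by omega⟩
    have h0 : c - 2 ^ v c ≠ 0 := by omega
    by_contra! hv
    have hb := testBit_v h0
    rcases hv.lt_or_eq with hv | hv
    · have h1 : (2 ^ v c + (c - 2 ^ v c)).testBit (v (c - 2 ^ v c)) = true := by
        rw [Nat.testBit_two_pow_add_gt hv]
        exact hb
      rw [Nat.add_sub_cancel' hle] at h1
      exact absurd (v_le h1) (by omega)
    · rw [hv] at hb
      have h1 := Nat.testBit_two_pow_add_eq (c - 2 ^ v c) (v c)
      rw [Nat.add_sub_cancel' hle, testBit_v hc, hb] at h1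
      simp at h1

theorem w_pos {c : ℕ} (hc : c ≠ 0) : 0 < w c := by
  rcases eq_two_pow_or hc with h | ⟨y, c', -, h, rfl⟩
  · rw [h, w_two_pow]
    exact one_pos
  · rw [w_two_pow_add h]
    exact Nat.succ_pos _

theorem eq_two_pow_of_w_eq_one {c : ℕ} (hc : c ≠ 0) (hw : w c = 1) : c = 2 ^ v c := by
  rcases eq_two_pow_or hc with h | ⟨y, c', h0, h, rfl⟩
  · exact h
  · rw [w_two_pow_add h] at hw
    have := w_pos h0
    omega

/-- Adds the colour `c` to the first part. -/
def addColour (c : ℕ) : List CPart → List CPart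
  | [] => []
  | (m, c', b) :: P => (m, c + c', b) :: P

/-- The coloured overpartition with a given spelled-out form. -/
def collapse : List Entry → List CPart
  | [] => []
  | (y, some (m, b)) :: L => (m, 2 ^ y, b) :: collapse L
  | (y, none) :: L => addColour (2 ^ y) (collapse L)

theorem collapse_cons {y : ℕ} {o : Option (ℕ × Bool)} {L : List Entry}
    (hL : Valid ((y, o) :: L)) :
    ∃ m c b P, collapse ((y, o) :: L) = (m, c, b) :: P ∧ c ≠ 0 ∧ v c = y ∧
      need ((y, o) :: L) + 1 = m + w c + chi b := by
  induction L generalizing y o with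
  | nil =>
    rcases o with _ | ⟨m, b⟩
    · simp [Valid, asc] at hL
    · refine ⟨m, 2 ^ y, b, [], rfl, by simp, v_two_pow y, ?_⟩
      rw [w_two_pow]
      simp only [need]
      omega
  | cons e L ih =>
    obtain ⟨y₁, o₁⟩ := e
    rcases o with _ | ⟨m, b⟩
    · obtain ⟨h1, h2⟩ := hL
      obtain ⟨m, c, b, P, h3, h4, rfl, h6⟩ := ih h2
      have hy : y < v c := by
        rw [asc_cons, up] at h1
        split_ifs at h1 with h
        exact h
      refine ⟨m, 2 ^ y + c, b, P, by simp [collapse.eq_3, h3, addColour], by simp [h4],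
        v_two_pow_add hy, ?_⟩
      rw [need.eq_3, h1, w_two_pow_add hy]
      omega
    · refine ⟨m, 2 ^ y, b, collapse ((y₁, o₁) :: L), rfl, by simp, v_two_pow y, ?_⟩
      rw [w_two_pow, need.eq_2]
      omega

theorem collapse_none {y : ℕ} {L : List Entry} (hL : Valid ((y, none) :: L)) :
    ∃ m c b P, collapse L = (m, c, b) :: P ∧ c ≠ 0 ∧ y < v c ∧
      collapse ((y, none) :: L) = (m, 2 ^ y + c, b) :: P := by
  rcases L with _ | ⟨⟨y₁, o₁⟩, L⟩
  · simp [Valid, asc] at hL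
  · obtain ⟨h1, h2⟩ := hL
    obtain ⟨m, c, b, P, h3, h4, rfl, -⟩ := collapse_cons h2
    refine ⟨m, c, b, P, h3, h4, ?_, by simp [collapse.eq_3, h3, addColour]⟩
    rw [asc_cons, up] at h1
    split_ifs at h1 with h
    exact h

theorem diffCond_iff {y o L m c b P} (hL : Valid ((y, o) :: L))
    (h : collapse ((y, o) :: L) = (m, c, b) :: P) (m₀ c₀ : ℕ) (b₀ : Bool) :
    DiffCond (m₀, c₀, b₀) (m, c, b) ↔ need ((y, o) :: L) + asc (z c₀) ((y, o) :: L) ≤ m₀ := by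
  obtain ⟨m', c', b', P', h1, h2, h3, h4⟩ := collapse_cons hL
  rw [h, List.cons.injEq, Prod.mk.injEq, Prod.mk.injEq] at h1
  obtain ⟨⟨rfl, rfl, rfl⟩, -⟩ := h1
  have h5 : delta c₀ c = asc (z c₀) ((y, o) :: L) := by rw [asc_cons, ← h3]; rfl
  rw [← h5]
  simp only [DiffCond]
  omega

theorem isChain_collapse {L : List Entry} (hL : Valid L) :
    (collapse L).IsChain DiffCond := by
  induction L with
  | nil => simp [collapse]
  | cons e L ih =>
    obtain ⟨y, _ | ⟨m, b⟩⟩ := e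
    · obtain ⟨m, c, b, P, h1, h2, h3, h4⟩ := collapse_none hL
      have hc := ih hL.2
      rw [h1] at hc
      rw [h4]
      refine hc.imp_head fun {q} hq => ?_
      simpa only [DiffCond, delta, z_two_pow_add h2 h3] using hq
    · rw [collapse.eq_2]
      have hc := ih hL.2
      rcases L with _ | ⟨⟨y₁, o₁⟩, L⟩
      · simp [collapse]
      · obtain ⟨m₁, c₁, b₁, P, h1, -⟩ := collapse_cons hL.2
        rw [h1] at hc ⊢
        rw [List.isChain_cons_cons, diffCond_iff hL.2 h1, z_two_pow]
        exact ⟨hL.1, hc⟩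

theorem collapse_injOn : Set.InjOn collapse {L | Valid L} := by
  intro L hL L' hL' h
  induction L generalizing L' with
  | nil =>
    rcases L' with _ | ⟨⟨y', o'⟩, L'⟩
    · rfl
    · obtain ⟨m, c, b, P, h1, -⟩ := collapse_cons hL'
      rw [h1] at h
      simp [collapse] at h
  | cons e L ih =>
    obtain ⟨y, o⟩ := e
    obtain ⟨m, c, b, P, h1, h2, rfl, -⟩ := collapse_cons hL
    rcases L' with _ | ⟨⟨y', o'⟩, L'⟩
    · rw [h1] at h
      simp [collapse] at h
    · obtain ⟨m', c', b', P', h1', h2', rfl, -⟩ := collapse_cons hL'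
      have h0 := h
      rw [h1, h1', List.cons.injEq, Prod.mk.injEq, Prod.mk.injEq] at h0
      obtain ⟨⟨rfl, rfl, rfl⟩, rfl⟩ := h0
      rcases o with _ | ⟨m₁, b₁⟩ <;> rcases o' with _ | ⟨m₂, b₂⟩
      · obtain ⟨n, d, a, Q, i1, -, -, i4⟩ := collapse_none hL
        obtain ⟨n', d', a', Q', i1', -, -, i4'⟩ := collapse_none hL'
        rw [i4, i4'] at h
        simp only [List.cons.injEq, Prod.mk.injEq, Nat.add_left_cancel_iff] at h
        obtain ⟨⟨rfl, rfl, rfl⟩, rfl⟩ := h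
        rw [ih hL.2 hL'.2 (i1.trans i1'.symm)]
      · obtain ⟨n, d, a, Q, i1, i2, i3, i4⟩ := collapse_none hL
        rw [i4, collapse.eq_2] at h
        simp only [List.cons.injEq, Prod.mk.injEq] at h
        omega
      · obtain ⟨n, d, a, Q, i1, i2, i3, i4⟩ := collapse_none hL'
        rw [i4, collapse.eq_2] at h
        simp only [List.cons.injEq, Prod.mk.injEq] at h
        omega
      · simp only [collapse.eq_2, List.cons.injEq, Prod.mk.injEq, true_and] at h
        obtain ⟨⟨rfl, rfl⟩, h⟩ := h
        rw [ih hL.2 hL'.2 h]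

theorem exists_collapse {P : List CPart} (hc : ∀ p ∈ P, p.2.1 ≠ 0)
    (hP : P.IsChain DiffCond) : ∃ L, Valid L ∧ collapse L = P := by
  induction P with
  | nil => exact ⟨[], trivial, rfl⟩
  | cons p P ih =>
    obtain ⟨m, c, b⟩ := p
    have hc0 : c ≠ 0 := hc (m, c, b) (by simp)
    obtain ⟨L, hL, rfl⟩ := ih (fun p hp => hc p (List.mem_cons_of_mem _ hp)) hP.tail
    clear ih hc
    induction c using Nat.strong_induction_on with
    | _ c ih =>
      rcases eq_two_pow_or hc0 with h | ⟨y, c', h1, h2, rfl⟩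
      · refine ⟨(v c, some (m, b)) :: L, ⟨?_, hL⟩, by rw [collapse.eq_2, ← h]⟩
        rcases L with _ | ⟨⟨y₁, o₁⟩, L⟩
        · simp [need, asc]
        · obtain ⟨m₁, c₁, b₁, P, h1, -⟩ := collapse_cons hL
          rw [h1, List.isChain_cons_cons, diffCond_iff hL h1] at hP
          have hz : z c = v c := by
            rw [h, z_two_pow, v_two_pow]
          rw [← hz]
          exact hP.1
      · have hlt : c' < 2 ^ y + c' := by simp
        have hP' : ((m, c', b) :: collapse L).IsChain DiffCond := hP.imp_head fun {q} hq => by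
          simpa only [DiffCond, delta, z_two_pow_add h1 h2] using hq
        obtain ⟨L', h3, h4⟩ := ih c' hlt h1 hP'
        refine ⟨(y, none) :: L', ⟨?_, h3⟩, by rw [collapse.eq_3, h4]; rfl⟩
        rcases L' with _ | ⟨⟨y₁, o₁⟩, L'⟩
        · simp [collapse] at h4
        · obtain ⟨m₁, c₁, b₁, P, h5, -, h6, -⟩ := collapse_cons h3
          rw [h4, List.cons.injEq, Prod.mk.injEq, Prod.mk.injEq] at h5
          obtain ⟨⟨rfl, rfl, rfl⟩, -⟩ := h5
          rw [asc_cons, up, if_pos (h6 ▸ h2)]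

theorem countP_testBit_collapse {L : List Entry} (hL : Valid L) (i : ℕ) :
    (collapse L).countP (fun p => p.2.1.testBit i) = (L.map Prod.fst).count i := by
  induction L with
  | nil => rfl
  | cons e L ih =>
    obtain ⟨y, _ | ⟨m, b⟩⟩ := e
    · obtain ⟨m, c, b, P, h1, h2, h3, h4⟩ := collapse_none hL
      rw [h4, List.map_cons, List.count_cons, ← ih hL.2, h1, List.countP_cons, List.countP_cons]
      simp only [testBit_two_pow_add h3]
      rcases eq_or_ne y i with rfl | hy
      · have : c.testBit y = false := by
          by_contra hb
          have := v_le (Bool.not_eq_false _ ▸ hb)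
          omega
        simp [this]
      · simp [hy]
    · rw [collapse.eq_2, List.map_cons, List.count_cons, ← ih hL.2, List.countP_cons]
      simp [Nat.testBit_two_pow]

theorem sum_collapse {L : List Entry} (hL : Valid L) :
    ((collapse L).map Prod.fst).sum = (L.map esize).sum := by
  induction L with
  | nil => rfl
  | cons e L ih =>
    obtain ⟨y, _ | ⟨m, b⟩⟩ := e
    · obtain ⟨m, c, b, P, h1, h2, h3, h4⟩ := collapse_none hL
      rw [h4, List.map_cons, List.sum_cons, List.map_cons, List.sum_cons, ← ih hL.2, h1]
      simp [esize]
    · rw [collapse.eq_2, List.map_cons, List.map_cons, List.sum_cons, List.sum_cons, ← ih hL.2]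
      simp [esize]

theorem countP_collapse {L : List Entry} (hL : Valid L) :
    (collapse L).countP (fun p => !p.2.2) = L.countP isPlain := by
  induction L with
  | nil => rfl
  | cons e L ih =>
    obtain ⟨y, _ | ⟨m, b⟩⟩ := e
    · obtain ⟨m, c, b, P, h1, h2, h3, h4⟩ := collapse_none hL
      rw [h4, List.countP_cons, List.countP_cons, ← ih hL.2, h1, List.countP_cons]
      simp [isPlain]
    · rw [collapse.eq_2, List.countP_cons, List.countP_cons, ← ih hL.2]
      simp [isPlain]

theorem colour_ne_zero_of_mem_collapse {L : List Entry} (hL : Valid L) :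
    ∀ p ∈ collapse L, p.2.1 ≠ 0 := by
  induction L with
  | nil => simp [collapse]
  | cons e L ih =>
    obtain ⟨y, _ | ⟨m, b⟩⟩ := e
    · obtain ⟨m, c, b, P, h1, h2, h3, h4⟩ := collapse_none hL
      have hc := ih hL.2
      rw [h1] at hc
      rw [h4]
      simp only [List.mem_cons, forall_eq_or_imp] at hc ⊢
      exact ⟨by simp [h2], hc.2⟩
    · rw [collapse.eq_2]
      simpa using ih hL.2

theorem letters_lt_iff {L : List Entry} (hL : Valid L) (r : ℕ) :
    (∀ y ∈ L.map Prod.fst, y < r) ↔ ∀ p ∈ collapse L, p.2.1 < 2 ^ r := by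
  have key : ∀ y, y ∈ L.map Prod.fst ↔ ∃ p ∈ collapse L, p.2.1.testBit y = true := fun y => by
    rw [← List.count_pos_iff, ← countP_testBit_collapse hL, List.countP_pos_iff]
  constructor
  · intro h p hp
    refine Nat.lt_pow_two_of_testBit _ fun i hi => ?_
    by_contra hb
    have := h i ((key i).2 ⟨p, hp, by simpa using hb⟩)
    omega
  · intro h y hy
    obtain ⟨p, hp, hb⟩ := (key y).1 hy
    exact (Nat.pow_lt_pow_iff_right (by norm_num)).1
      ((Nat.ge_two_pow_of_testBit hb).trans_lt (h p hp))

/-- A transitive consequence of the difference condition. -/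
def WeakDiff (p q : CPart) : Prop :=
  q.1 < p.1 ∨ (p.1 = q.1 ∧ q.2.1 ≤ p.2.1 ∧ q.2.2 = false)

instance : IsTrans CPart WeakDiff :=
  ⟨fun p q s h h' => by unfold WeakDiff at *; grind⟩

theorem DiffCond.weakDiff {p q : CPart} (h : DiffCond p q) (hp : p.2.1 ≠ 0) (hq : q.2.1 ≠ 0) :
    WeakDiff p q := by
  obtain ⟨m, c, b⟩ := p
  obtain ⟨m', c', b'⟩ := q
  simp only [DiffCond, WeakDiff] at *
  have hw := w_pos hq
  by_cases hm : m' < m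
  · exact Or.inl hm
  · have h1 : w c' = 1 := by omega
    have h2 : chi b' = 0 := by omega
    have h3 : delta c c' = 0 := by omega
    refine Or.inr ⟨by omega, ?_, ?_⟩
    · rw [eq_two_pow_of_w_eq_one hq h1]
      have h4 : v c' ≤ z c := by
        by_contra! h4
        simp [delta, h4] at h3
      exact (Nat.pow_le_pow_right (by norm_num) h4).trans
        (Nat.ge_two_pow_of_testBit (testBit_z hp))
    · cases b'
      · rfl
      · simp [chi] at h2

theorem isColouredOverpartition_of_diffCond {P : List CPart} (hc : ∀ p ∈ P, p.2.1 ≠ 0)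
    (hP : P.IsChain DiffCond) : IsColouredOverpartition P := by
  have h : P.Pairwise WeakDiff := (hP.imp_of_mem_imp
    fun p q hp hq h => h.weakDiff (hc p hp) (hc q hq)).pairwise
  refine ⟨List.IsChain.imp ?_ h.isChain, h.imp ?_⟩
  · intro p q h
    unfold WeakDiff at h
    unfold COrder
    grind
  · intro p q h
    unfold WeakDiff at h
    grind

/-- The overpartitions counted by `Ebar`. -/
def EbarSet {r : ℕ} (ℓ : Fin r → ℕ) (k n : ℕ) : Set (List CPart) :=
  {L | IsColouredOverpartition L ∧
    (L.map Prod.fst).sum = n ∧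
    (∀ p ∈ L, 1 ≤ p.2.1 ∧ p.2.1 ≤ 2 ^ r - 1) ∧
    (∀ i : Fin r, L.countP (fun p => p.2.1.testBit (i : ℕ)) = ℓ i) ∧
    L.countP (fun p => !p.2.2) = k ∧
    L.IsChain DiffCond}

theorem bijOn_collapse {r : ℕ} (ℓ : Fin r → ℕ) (k n : ℕ) :
    Set.BijOn collapse (entrySet ℓ k n) (EbarSet ℓ k n) := by
  have hr : 0 < 2 ^ r := by positivity
  refine ⟨?_, collapse_injOn.mono fun L hL => hL.1, ?_⟩
  · rintro L ⟨hL, hw, hn, hk⟩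
    have h0 := colour_ne_zero_of_mem_collapse hL
    have hc := isChain_collapse hL
    refine ⟨isColouredOverpartition_of_diffCond h0 hc, by rwa [sum_collapse hL],
      fun p hp => ⟨Nat.one_le_iff_ne_zero.2 (h0 p hp), ?_⟩,
      fun i => by rw [countP_testBit_collapse hL, hw.2], by rwa [countP_collapse hL], hc⟩
    have := (letters_lt_iff hL r).1 hw.1 p hp
    omega
  · rintro P ⟨-, hn, hr', hl, hk, hc⟩
    obtain ⟨L, hL, rfl⟩ := exists_collapse
      (fun p hp => Nat.one_le_iff_ne_zero.1 (hr' p hp).1) hc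
    refine ⟨L, ⟨hL, ⟨(letters_lt_iff hL r).2 fun p hp => ?_, fun i => ?_⟩, ?_, ?_⟩, rfl⟩
    · have := hr' p hp
      omega
    · rw [← countP_testBit_collapse hL, hl]
    · rwa [← sum_collapse hL]
    · rwa [← countP_collapse hL]

theorem before_iff {p q : ℕ × ℕ} : Before p q ↔ p.2 < q.2 ∨ (p.2 = q.2 ∧ p.1 < q.1) := by
  unfold Before up
  split_ifs <;> omega

theorem after_iff {p q : ℕ × ℕ} : After p q ↔ q.2 < p.2 ∨ (p.2 = q.2 ∧ q.1 ≤ p.1) := by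
  unfold After up
  split_ifs <;> omega

instance : IsTrans (ℕ × ℕ) Before :=
  ⟨fun p q s h h' => by rw [before_iff] at *; omega⟩

instance : IsTrans (ℕ × ℕ) After :=
  ⟨fun p q s h h' => by rw [after_iff] at *; omega⟩

instance : IsTrans CPart COrder :=
  ⟨fun p q s h h' => by unfold COrder at *; grind⟩

instance : Std.Total COrder :=
  ⟨fun p q => by unfold COrder; grind⟩

instance : DecidableRel COrder := fun p q => by unfold COrder; infer_instance

theorem COrder.antisymm {p q : CPart} (h : COrder p q) (h' : COrder q p) : p = q := by
  obtain ⟨m, c, b⟩ := p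
  obtain ⟨m', c', b'⟩ := q
  unfold COrder at *
  grind

/-- The part with given letter and size. -/
def part (b : Bool) (p : ℕ × ℕ) : CPart := (p.2, 2 ^ p.1, b)

theorem part_injective (b : Bool) : Function.Injective (part b) := by
  rintro ⟨y, m⟩ ⟨y', m'⟩ h
  simp only [part, Prod.mk.injEq, Nat.pow_right_inj (le_refl 2)] at h
  simp [h]

theorem cOrder_part {b : Bool} {p q : ℕ × ℕ} : COrder (part b p) (part b q) ↔ After p q := by
  rw [after_iff]
  simp only [COrder, part, Nat.pow_lt_pow_iff_right (le_refl 2), Nat.pow_right_inj (le_refl 2)]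
  cases b <;> simp <;> omega

/-- All parts encoded by a pair of lists, in no particular order. -/
def parts (P : List (ℕ × ℕ) × List (ℕ × ℕ)) : List CPart :=
  P.1.map (part true) ++ P.2.map (part false)

/-- The coloured overpartition encoded by a pair of lists. -/
def sortParts (P : List (ℕ × ℕ) × List (ℕ × ℕ)) : List CPart :=
  (parts P).insertionSort COrder

theorem sortParts_perm (P : List (ℕ × ℕ) × List (ℕ × ℕ)) : (sortParts P).Perm (parts P) :=
  List.perm_insertionSort _ _

theorem pairwise_sortParts (P : List (ℕ × ℕ) × List (ℕ × ℕ)) :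
    (sortParts P).Pairwise COrder :=
  List.pairwise_insertionSort _ _

theorem filter_overlined_parts (P : List (ℕ × ℕ) × List (ℕ × ℕ)) :
    (parts P).filter (fun p => p.2.2) = P.1.map (part true) := by
  simp [parts, List.filter_map, Function.comp_def, part]

theorem filter_not_overlined_parts (P : List (ℕ × ℕ) × List (ℕ × ℕ)) :
    (parts P).filter (fun p => !p.2.2) = P.2.map (part false) := by
  simp [parts, List.filter_map, Function.comp_def, part]

theorem noDupOverlined_perm {L L' : List CPart} (h : L.Perm L') :
    NoDupOverlined L ↔ NoDupOverlined L' :=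
  h.pairwise_iff fun h h1 h2 h3 => h h2 h1 ⟨h3.1.symm, h3.2.symm⟩

theorem noDupOverlined_parts {A B : List (ℕ × ℕ)} (hA : A.Pairwise Before) :
    NoDupOverlined (parts (A, B)) := by
  unfold NoDupOverlined parts
  rw [List.pairwise_append, List.pairwise_map, List.pairwise_map]
  refine ⟨hA.imp fun {p q} h _ _ h' => ?_, ?_, ?_⟩
  · rw [before_iff] at h
    simp only [part, Nat.pow_right_inj (le_refl 2)] at h'
    omega
  · exact List.pairwise_of_forall fun p q h => by simp [part] at h
  · intro p hp q hq _ h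
    obtain ⟨q', -, rfl⟩ := List.mem_map.1 hq
    simp [part] at h

theorem sum_parts (P : List (ℕ × ℕ) × List (ℕ × ℕ)) :
    ((parts P).map Prod.fst).sum = ((P.1 ++ P.2).map Prod.snd).sum := by
  simp [parts, Function.comp_def, part]

theorem countP_overlined_parts (P : List (ℕ × ℕ) × List (ℕ × ℕ)) :
    (parts P).countP (fun p => !p.2.2) = P.2.length := by
  rw [List.countP_eq_length_filter, filter_not_overlined_parts, List.length_map]

theorem countP_colour_parts (P : List (ℕ × ℕ) × List (ℕ × ℕ)) (i : ℕ) :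
    (parts P).countP (fun p => p.2.1 == 2 ^ i) = ((P.1 ++ P.2).map Prod.fst).count i := by
  have key : ∀ y : ℕ, (2 ^ y == 2 ^ i) = (y == i) := fun y => by
    rw [Bool.eq_iff_iff, beq_iff_eq, beq_iff_eq, Nat.pow_right_inj (le_refl 2)]
  simp only [parts, part, List.countP_append, List.countP_map, Function.comp_def, List.count,
    List.map_append, key]

theorem letters_lt_parts (P : List (ℕ × ℕ) × List (ℕ × ℕ)) (r : ℕ) :
    (∀ p ∈ parts P, ∃ i : Fin r, p.2.1 = 2 ^ (i : ℕ)) ↔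
      ∀ y ∈ (P.1 ++ P.2).map Prod.fst, y < r := by
  have key : ∀ y : ℕ, (∃ i : Fin r, 2 ^ y = 2 ^ (i : ℕ)) ↔ y < r := fun y =>
    ⟨fun ⟨i, hi⟩ => Nat.pow_right_injective (le_refl 2) hi ▸ i.2, fun h => ⟨⟨y, h⟩, rfl⟩⟩
  simp only [parts, part, List.forall_mem_append, List.forall_mem_map, List.map_append, key]

theorem exists_map_part {r : ℕ} {b : Bool} {L : List CPart}
    (hc : ∀ p ∈ L, ∃ i : Fin r, p.2.1 = 2 ^ (i : ℕ)) (hb : ∀ p ∈ L, p.2.2 = b) :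
    ∃ A : List (ℕ × ℕ), A.map (part b) = L := by
  suffices L ∈ Set.range (List.map (part b)) from this
  rw [Set.range_list_map]
  intro p hp
  obtain ⟨i, hi⟩ := hc p hp
  exact ⟨(i, p.1), Prod.ext rfl (Prod.ext hi.symm (hb p hp).symm)⟩

/-- The overpartitions counted by `Dbar`. -/
def DbarSet {r : ℕ} (ℓ : Fin r → ℕ) (k n : ℕ) : Set (List CPart) :=
  {L | IsColouredOverpartition L ∧
    (L.map Prod.fst).sum = n ∧
    (∀ p ∈ L, ∃ i : Fin r, p.2.1 = 2 ^ (i : ℕ)) ∧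
    (∀ i : Fin r, L.countP (fun p => p.2.1 == 2 ^ (i : ℕ)) = ℓ i) ∧
    L.countP (fun p => !p.2.2) = k}

theorem sortParts_injOn :
    Set.InjOn sortParts {P | P.1.IsChain Before ∧ P.2.IsChain After} := by
  rintro ⟨A, B⟩ ⟨hA, hB⟩ ⟨A', B'⟩ ⟨hA', hB'⟩ h
  have hp : (parts (A, B)).Perm (parts (A', B')) :=
    (sortParts_perm _).symm.trans (h ▸ sortParts_perm _)
  have h1 := hp.filter (fun p => p.2.2)
  have h2 := hp.filter (fun p => !p.2.2)
  rw [filter_overlined_parts, filter_overlined_parts,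
    List.map_perm_map_iff (part_injective true)] at h1
  rw [filter_not_overlined_parts, filter_not_overlined_parts,
    List.map_perm_map_iff (part_injective false)] at h2
  refine Prod.ext (h1.eq_of_pairwise ?_ hA.pairwise hA'.pairwise)
    (h2.eq_of_pairwise ?_ hB.pairwise hB'.pairwise)
  · intro p q _ _ h3 h4
    rw [before_iff] at h3 h4
    omega
  · intro p q _ _ h3 h4
    rw [after_iff] at h3 h4
    exact Prod.ext (by omega) (by omega)

theorem exists_sortParts {r : ℕ} {L : List CPart} (hL : IsColouredOverpartition L)
    (hc : ∀ p ∈ L, ∃ i : Fin r, p.2.1 = 2 ^ (i : ℕ)) :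
    ∃ A B : List (ℕ × ℕ), A.IsChain Before ∧ B.IsChain After ∧ sortParts (A, B) = L := by
  have hs : L.Pairwise COrder := List.IsChain.pairwise hL.1
  obtain ⟨A, hA⟩ := exists_map_part (b := true) (L := L.filter (fun p => p.2.2))
    (fun p hp => hc p (List.mem_of_mem_filter hp)) (fun p hp => (List.mem_filter.1 hp).2)
  obtain ⟨B, hB⟩ := exists_map_part (b := false) (L := L.filter (fun p => !p.2.2))
    (fun p hp => hc p (List.mem_of_mem_filter hp))
    (fun p hp => by simpa using (List.mem_filter.1 hp).2)
  refine ⟨A.reverse, B, ?_, ?_, ?_⟩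
  · rw [List.isChain_reverse]
    have h1 := hs.filter (fun p => p.2.2)
    have h2 := List.Pairwise.filter (fun p => p.2.2) hL.2
    rw [← hA, List.pairwise_map] at h1 h2
    refine (h1.imp₂ (fun p q h3 h4 => ?_) h2).isChain
    rw [cOrder_part, after_iff] at h3
    rw [before_iff]
    have h5 := h4 rfl rfl
    simp only [part, Nat.pow_right_inj (le_refl 2)] at h5
    omega
  · have h1 := hs.filter (fun p => !p.2.2)
    rw [← hB, List.pairwise_map] at h1
    exact (h1.imp cOrder_part.1).isChain
  · refine List.Perm.eq_of_pairwise (fun p q _ _ h h' => h.antisymm h')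
      (pairwise_sortParts _) hs ((sortParts_perm _).trans ?_)
    simp only [parts, List.map_reverse, hA, hB]
    exact ((List.reverse_perm _).append_right _).trans (List.filter_append_perm _ _)

theorem bijOn_sortParts {r : ℕ} (ℓ : Fin r → ℕ) (k n : ℕ) :
    Set.BijOn sortParts (pairSet ℓ k n) (DbarSet ℓ k n) := by
  have key : ∀ P : List (ℕ × ℕ) × List (ℕ × ℕ), P.1.IsChain Before → P.2.IsChain After →
      (sortParts P ∈ DbarSet ℓ k n ↔ P ∈ pairSet ℓ k n) := by
    rintro P hA hB
    have hp := sortParts_perm P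
    have h1 : IsColouredOverpartition (sortParts P) :=
      ⟨(pairwise_sortParts P).isChain,
        (noDupOverlined_perm hp).2 (noDupOverlined_parts hA.pairwise)⟩
    simp only [DbarSet, pairSet, Set.mem_ofPred_eq, h1, hA, hB, true_and, IsWord,
      (hp.map Prod.fst).sum_eq, hp.mem_iff, hp.countP_eq, sum_parts, letters_lt_parts,
      countP_colour_parts, countP_overlined_parts]
    tauto
  refine ⟨fun P hP => (key P hP.1 hP.2.1).2 hP,
    fun P hP Q hQ h => sortParts_injOn ⟨hP.1, hP.2.1⟩ ⟨hQ.1, hQ.2.1⟩ h, fun L hL => ?_⟩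
  obtain ⟨A, B, hA, hB, rfl⟩ := exists_sortParts hL.1 hL.2.2.1
  exact ⟨(A, B), (key (A, B) hA hB).1 hL, rfl⟩

/-- Theorem `refinement`. -/
theorem statement0 (r : ℕ) (hr : 1 ≤ r) (ℓ : Fin r → ℕ) (k n : ℕ) :
    Dbar r ℓ k n = Ebar r ℓ k n :=
  Nat.card_congr ((bijOn_sortParts ℓ k n).equiv.symm.trans
    ((bijOn_build ℓ k n).equiv.trans (bijOn_collapse ℓ k n).equiv))

end Stmt0
end

section
/- For all integers ℓ_1,…,ℓ_r, k, m, n ≥ 0 the following hold (where p is 0 whenever one of its arguments is negative): (i) for every 1 ≤ j ≤ 2^r − 2, p_(0_(ũ_j))(ℓ_1,…,ℓ_r;k,m,n) − p_(0_(ũ_(j+1)))(ℓ_1,…,ℓ_r;k,m,n) = p_(0_(u_(v(ũ_j))))(ℓ_1 − ε_1(j), …, ℓ_r − ε_r(j); k, m−1, n − (m−1)·w(ũ_j)) + p_(0_(u_(v(ũ_j))))(ℓ_1 − ε_1(j), …, ℓ_r − ε_r(j); k−1, m−1, n − (m−1)·(w(ũ_j) − 1)); (ii) p_(0_(ũ_(2^r−1)))(ℓ_1,…,ℓ_r;k,m,n)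 − p_(1_(ũ_1))(ℓ_1,…,ℓ_r;k,m,n) = p_(0_(u_1))(ℓ_1 − 1, …, ℓ_r − 1; k, m−1, n − (m−1)·r) + p_(0_(u_1))(ℓ_1 − 1, …, ℓ_r − 1; k−1, m−1, n − (m−1)·(r−1)); (iii) p_(1_(ũ_1))(ℓ_1,…,ℓ_r;k,m,n) = p_(0_(ũ_1))(ℓ_1,…,ℓ_r;k,m,n − m). -/
namespace Stmt9

/-- A coloured part: (size, colour, overlined?).  Colours are indexed by
`j ∈ {1, …, 2^r - 1}`, the colour `ũ_j` containing the primary colour `u_{k+1}`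
iff the binary digit `2^k` appears in `j`. -/
abbrev CPart : Type := ℕ × ℕ × Bool

/-- Total order used to list the parts canonically: size first, then colour,
and among parts of equal size and colour the overlined one comes first. -/
def COrder (p q : CPart) : Prop :=
  q.1 < p.1 ∨ (p.1 = q.1 ∧
    (q.2.1 < p.2.1 ∨ (p.2.1 = q.2.1 ∧ (p.2.2 = true ∨ q.2.2 = false))))

/-- At most one overlined part of each given size and colour. -/
def NoDupOverlined (L : List CPart) : Prop :=
  L.Pairwise (fun p q => p.2.2 = true → q.2.2 = true → ¬(p.1 = q.1 ∧ p.2.1 = q.2.1))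

/-- A coloured overpartition (listed canonically). -/
def IsColouredOverpartition (L : List CPart) : Prop :=
  List.Chain' COrder L ∧ NoDupOverlined L

/-- `w`: the number of primary colours of the colour `c` (number of binary ones). -/
def w (c : ℕ) : ℕ := (Nat.digits 2 c).sum

/-- index (0-based) of the smallest primary colour appearing in `c`. -/
noncomputable def v (c : ℕ) : ℕ := sInf {k : ℕ | c.testBit k = true}

/-- index (0-based) of the largest primary colour appearing in `c`. -/
noncomputable def z (c : ℕ) : ℕ := sSup {k : ℕ | c.testBit k = true}

/-- `δ(c, c') = 1` if `z c < v c'` and `0` otherwise. -/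
noncomputable def delta (c c' : ℕ) : ℕ := if z c < v c' then 1 else 0

def chi (b : Bool) : ℕ := if b then 1 else 0

/-- The difference condition
`λ_i - λ_{i+1} ≥ w(c(λ_{i+1})) + χ(overlined λ_{i+1}) - 1 + δ(c(λ_i), c(λ_{i+1}))`. -/
noncomputable def DiffCond (p q : CPart) : Prop :=
  (w q.2.1 : ℤ) + chi q.2.2 - 1 + delta p.2.1 q.2.1 ≤ (p.1 : ℤ) - q.1

/-- `(size, colour)` of a part is `≥` the coloured integer `b = (i, ũ_j)` in the
order `0_(ũ_1) < ⋯ < 0_(ũ_(2^r-1)) < 1_(ũ_1) < ⋯`. -/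
def PartGE (x b : ℕ × ℕ) : Prop := b.1 < x.1 ∨ (x.1 = b.1 ∧ b.2 ≤ x.2)

/-- `p_(i_(ũ_j))(ℓ_1,…,ℓ_r;k,m,n)` with `b = (i, j)`: the number of coloured
overpartitions counted by `Ē(ℓ_1,…,ℓ_r;k,n)` having exactly `m` parts, all parts
being at least `i_(ũ_j)`.  The arguments `ℓ, k, m, n` are integers and the count
is `0` whenever one of them is negative. -/
noncomputable def pcount (r : ℕ) (b : ℕ × ℕ) (ℓ : Fin r → ℤ) (k m n : ℤ) : ℕ :=
  Nat.card {L : List CPart //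
    IsColouredOverpartition L ∧
    (∀ p ∈ L, 1 ≤ p.2.1 ∧ p.2.1 ≤ 2 ^ r - 1) ∧
    (∀ i : Fin r, (L.countP (fun p => p.2.1.testBit (i : ℕ)) : ℤ) = ℓ i) ∧
    (L.countP (fun p => !p.2.2) : ℤ) = k ∧
    List.Chain' DiffCond L ∧
    (L.length : ℤ) = m ∧
    ((L.map Prod.fst).sum : ℤ) = n ∧
    ∀ p ∈ L, PartGE (p.1, p.2.1) b}

/-- Adding `s` to the size of a part. -/
def shift (s : ℕ) (p : CPart) : CPart := (p.1 + s, p.2)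

lemma shift_injective (s : ℕ) : Function.Injective (shift s) := by
  rintro ⟨a, c⟩ ⟨b, d⟩ h
  simpa [shift] using h

lemma cOrder_trans {p q t : CPart} (h₁ : COrder p q) (h₂ : COrder q t) : COrder p t := by
  unfold COrder at *
  grind

instance : IsTrans CPart COrder := ⟨fun _ _ _ => cOrder_trans⟩

lemma cOrder_shift (s : ℕ) (p q : CPart) : COrder (shift s p) (shift s q) ↔ COrder p q := by
  simp [COrder, shift]

lemma diffCond_shift (s : ℕ) (p q : CPart) :
    DiffCond (shift s p) (shift s q) ↔ DiffCond p q := by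
  simp [DiffCond, shift]

lemma partGE_of_cOrder {p q : CPart} {b : ℕ × ℕ} (h : COrder p q) (hq : PartGE (q.1, q.2.1) b) :
    PartGE (p.1, p.2.1) b := by
  unfold COrder PartGE at *
  grind

lemma w_two_mul (n : ℕ) : w (2 * n) = w n := by
  rcases Nat.eq_zero_or_pos n with rfl | h
  · simp [w]
  · simp [w, Nat.digits_def' (b := 2) (n := 2 * n) (by norm_num) (by omega)]

lemma w_two_mul_add_one (n : ℕ) : w (2 * n + 1) = w n + 1 := by
  have h : (2 * n + 1) / 2 = n := by omega
  simp [w, h]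
  omega

lemma one_le_w {j : ℕ} (hj : 1 ≤ j) : 1 ≤ w j := by
  induction j using Nat.strong_induction_on with
  | _ j ih =>
    obtain ⟨i, rfl | rfl⟩ := Nat.even_or_odd' j
    · rw [w_two_mul]
      exact ih i (by omega) (by omega)
    · rw [w_two_mul_add_one]
      omega

lemma exists_eq_two_pow_of_w_eq_one {j : ℕ} (h : w j = 1) : ∃ e, j = 2 ^ e := by
  induction j using Nat.strong_induction_on with
  | _ j ih =>
    obtain ⟨i, rfl | rfl⟩ := Nat.even_or_odd' j
    · rcases Nat.eq_zero_or_pos i with rfl | hi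
      · simp [w] at h
      · rw [w_two_mul] at h
        obtain ⟨e, he⟩ := ih i (by omega) h
        exact ⟨e + 1, by rw [pow_succ]; omega⟩
    · rw [w_two_mul_add_one] at h
      have : ¬ 1 ≤ i := fun hi => by have := one_le_w hi; omega
      exact ⟨0, by omega⟩

lemma w_two_pow_sub_one (r : ℕ) : w (2 ^ r - 1) = r := by
  induction r with
  | zero => simp [w]
  | succ r ih =>
    have h : 2 ^ (r + 1) - 1 = 2 * (2 ^ r - 1) + 1 := by
      have := Nat.one_le_two_pow (n := r)
      rw [pow_succ]
      omega
    rw [h, w_two_mul_add_one, ih]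

lemma testBit_v {j : ℕ} (hj : 1 ≤ j) : j.testBit (v j) = true := by
  obtain ⟨i, hi⟩ := Nat.exists_testBit_of_ne_zero (by omega : j ≠ 0)
  exact Nat.sInf_mem (s := {k : ℕ | j.testBit k = true}) ⟨i, hi⟩

lemma two_pow_v_le {j : ℕ} (hj : 1 ≤ j) : 2 ^ v j ≤ j :=
  Nat.ge_two_pow_of_testBit (testBit_v hj)

lemma le_two_pow_v_of_w_eq_one {j : ℕ} (h : w j = 1) : j ≤ 2 ^ v j := by
  obtain ⟨e, rfl⟩ := exists_eq_two_pow_of_w_eq_one h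
  have := testBit_v (Nat.one_le_two_pow (n := e))
  rw [Nat.testBit_two_pow] at this
  simp at this
  rw [← this]

lemma v_two_pow_sub_one {r : ℕ} (hr : 1 ≤ r) : v (2 ^ r - 1) = 0 := by
  refine Nat.sInf_eq_zero.2 (Or.inl ?_)
  simp only [Set.mem_ofPred_eq, Nat.testBit_two_pow_sub_one]
  simpa using Nat.lt_of_lt_of_le Nat.zero_lt_one hr

lemma le_z_iff {c e : ℕ} (hc : 1 ≤ c) : e ≤ z c ↔ 2 ^ e ≤ c := by
  have hb : BddAbove {k : ℕ | c.testBit k = true} :=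
    ⟨c, fun k hk => Nat.lt_two_pow_self.le.trans (Nat.ge_two_pow_of_testBit hk)⟩
  constructor
  · intro h
    obtain ⟨i, hi⟩ := Nat.exists_testBit_of_ne_zero (by omega : c ≠ 0)
    have hz : c.testBit (z c) = true := Nat.sSup_mem (s := {k : ℕ | c.testBit k = true}) ⟨i, hi⟩ hb
    exact (Nat.pow_le_pow_right (by norm_num) h).trans (Nat.ge_two_pow_of_testBit hz)
  · intro h
    obtain ⟨i, hi, hi'⟩ := Nat.exists_ge_and_testBit_of_ge_two_pow h
    exact hi.trans (le_csSup hb hi')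

lemma delta_eq {c j : ℕ} (hc : 1 ≤ c) : delta c j = if 2 ^ v j ≤ c then 0 else 1 := by
  have := le_z_iff (e := v j) hc
  unfold delta
  grind

/-- The predicate whose solutions are counted by `pcount`. -/
def Counted (r : ℕ) (b : ℕ × ℕ) (ℓ : Fin r → ℤ) (k m n : ℤ) (L : List CPart) : Prop :=
  IsColouredOverpartition L ∧
    (∀ p ∈ L, 1 ≤ p.2.1 ∧ p.2.1 ≤ 2 ^ r - 1) ∧
    (∀ i : Fin r, (L.countP (fun p => p.2.1.testBit (i : ℕ)) : ℤ) = ℓ i) ∧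
    (L.countP (fun p => !p.2.2) : ℤ) = k ∧
    List.IsChain DiffCond L ∧
    (L.length : ℤ) = m ∧
    ((L.map Prod.fst).sum : ℤ) = n ∧
    ∀ p ∈ L, PartGE (p.1, p.2.1) b

lemma pcount_eq_ncard (r : ℕ) (b : ℕ × ℕ) (ℓ : Fin r → ℤ) (k m n : ℤ) :
    pcount r b ℓ k m n = {L | Counted r b ℓ k m n L}.ncard := rfl

lemma finite_counted (r : ℕ) (b : ℕ × ℕ) (ℓ : Fin r → ℤ) (k m n : ℤ) :
    {L | Counted r b ℓ k m n L}.Finite := by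
  let S : Set CPart := Set.Iic n.toNat ×ˢ (Set.Iic (2 ^ r - 1) ×ˢ Set.univ)
  have hS : S.Finite := (Set.finite_Iic _).prod ((Set.finite_Iic _).prod Set.finite_univ)
  have := hS.to_subtype
  refine ((List.finite_length_eq S m.toNat).image (List.map Subtype.val)).subset ?_
  rintro L ⟨-, hc, -, -, -, hm, hn, -⟩
  have hL : ∀ p ∈ L, p ∈ S := by
    intro p hp
    have := List.le_sum_of_mem (List.mem_map_of_mem (f := Prod.fst) hp)
    exact ⟨by simp only [Set.mem_Iic]; omega, (hc p hp).2, Set.mem_univ _⟩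
  lift L to List S using hL
  refine ⟨L, ?_, rfl⟩
  simp only [List.length_map] at hm
  simp only [Set.mem_ofPred_eq]
  omega

lemma isColouredOverpartition_map_shift (s : ℕ) (L : List CPart) :
    IsColouredOverpartition (L.map (shift s)) ↔ IsColouredOverpartition L := by
  unfold IsColouredOverpartition NoDupOverlined
  rw [List.pairwise_map]
  refine and_congr ?_ ?_
  · exact (List.isChain_map _).trans (by simp only [cOrder_shift]; rfl)
  · simp [shift]

lemma isChain_diffCond_map_shift (s : ℕ) (L : List CPart) :
    List.IsChain DiffCond (L.map (shift s)) ↔ List.IsChain DiffCond L :=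
  (List.isChain_map _).trans (by simp only [diffCond_shift])

lemma sum_map_shift (s : ℕ) (L : List CPart) :
    ((L.map (shift s)).map Prod.fst).sum = (L.map Prod.fst).sum + L.length * s := by
  induction L with
  | nil => simp
  | cons a L ih =>
    simp only [List.map_cons, List.sum_cons, ih, List.length_cons, shift]
    ring

lemma exists_map_shift {s : ℕ} {L : List CPart} (h : ∀ p ∈ L, s ≤ p.1) :
    ∃ L' : List CPart, L = L'.map (shift s) := by
  refine ⟨L.map fun p => (p.1 - s, p.2), ?_⟩
  rw [List.map_map]
  conv_lhs => rw [← List.map_id L]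
  refine List.map_congr_left fun p hp => ?_
  have := h p hp
  simp [shift, Nat.sub_add_cancel this]

lemma partGE_of_getLast {L : List CPart} (h : List.IsChain COrder L) {b : ℕ × ℕ}
    (hb : ∀ p ∈ L.getLast?, PartGE (p.1, p.2.1) b) : ∀ p ∈ L, PartGE (p.1, p.2.1) b := by
  obtain rfl | ⟨L, q, rfl⟩ := L.eq_nil_or_concat'
  · simp
  · have hq := hb q (by simp)
    rw [List.isChain_iff_pairwise, List.pairwise_append] at h
    intro p hp
    rcases List.mem_append.1 hp with hp | hp
    · exact partGE_of_cOrder (h.2.2 p hp q (by simp)) hq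
    · rwa [List.mem_singleton.1 hp]

lemma diffCond_shift_zero_iff {j s : ℕ} {o : Bool} (hs : s + 1 = w j + chi o) {p : CPart}
    (hp : 1 ≤ p.2.1) :
    DiffCond (shift s p) (0, j, o) ↔ PartGE (p.1, p.2.1) (0, 2 ^ v j) := by
  simp only [DiffCond, PartGE, shift, delta_eq hp]
  split_ifs <;> grind

lemma cOrder_shift_zero {j s : ℕ} (hj : 1 ≤ j) {o : Bool} (hs : s + 1 = w j + chi o) {p : CPart}
    (hp : PartGE (p.1, p.2.1) (0, 2 ^ v j)) : COrder (shift s p) (0, j, o) := by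
  have h1 := one_le_w hj
  rcases Nat.eq_zero_or_pos s with rfl | h
  · have ho : o = false := by
      cases o
      · rfl
      · simp [chi] at hs; omega
    subst ho
    have := le_two_pow_v_of_w_eq_one (j := j) (by simp [chi] at hs; omega)
    simp only [COrder, PartGE, shift] at *
    grind
  · exact Or.inl (by simp only [shift]; omega)

lemma isColouredOverpartition_snoc_iff (L : List CPart) (q : CPart) :
    IsColouredOverpartition (L ++ [q]) ↔ IsColouredOverpartition L ∧
      ∀ p ∈ L, COrder p q ∧ (p.2.2 = true → q.2.2 = true → ¬(p.1 = q.1 ∧ p.2.1 = q.2.1)) := by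
  have hc : ∀ M, List.Chain' COrder M ↔ List.Pairwise COrder M := fun M =>
    List.isChain_iff_pairwise
  simp only [IsColouredOverpartition, NoDupOverlined, hc, List.pairwise_append,
    List.pairwise_singleton, List.mem_singleton, forall_eq]
  grind

/-- Lists with all parts at least `0_(ũ_j)` ending in `0_(ũ_j)`, in terms of the shifted list of
their other parts. -/
lemma counted_snoc_iff {r j : ℕ} (hj : 1 ≤ j) (hjr : j ≤ 2 ^ r - 1) (ℓ : Fin r → ℤ) (k m n : ℤ)
    (o : Bool) {s : ℕ} (hs : s + 1 = w j + chi o) (L : List CPart) :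
    Counted r (0, j) ℓ k m n (L.map (shift s) ++ [(0, j, o)]) ↔
      Counted r (0, 2 ^ v j) (fun i => ℓ i - if j.testBit (i : ℕ) then 1 else 0)
        (k - if o then 0 else 1) (m - 1) (n - (m - 1) * s) L := by
  have hlast : (∀ p ∈ L, 1 ≤ p.2.1) → List.IsChain COrder L →
      ((∀ p ∈ L.getLast?, DiffCond (shift s p) (0, j, o)) ↔
        ∀ p ∈ L, PartGE (p.1, p.2.1) (0, 2 ^ v j)) := by
    intro h1 hc
    constructor
    · refine fun h => partGE_of_getLast hc fun p hp => ?_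
      exact (diffCond_shift_zero_iff hs (h1 p (List.mem_of_mem_getLast? hp))).1 (h p hp)
    · intro h p hp
      have hp' := List.mem_of_mem_getLast? hp
      exact (diffCond_shift_zero_iff hs (h1 p hp')).2 (h p hp')
  have hchain : List.IsChain DiffCond (L.map (shift s) ++ [(0, j, o)]) ↔
      List.IsChain DiffCond L ∧ ∀ p ∈ L.getLast?, DiffCond (shift s p) (0, j, o) := by
    rw [List.isChain_append, isChain_diffCond_map_shift, List.getLast?_map]
    cases L.getLast? <;> simp
  have hcol : IsColouredOverpartition (L.map (shift s) ++ [(0, j, o)]) ↔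
      IsColouredOverpartition L ∧ ∀ p ∈ L, COrder (shift s p) (0, j, o) ∧
        (p.2.2 = true → o = true → ¬(p.1 + s = 0 ∧ p.2.1 = j)) := by
    rw [isColouredOverpartition_snoc_iff, isColouredOverpartition_map_shift, List.forall_mem_map]
    simp [shift]
  have hrange : (∀ p ∈ L.map (shift s) ++ [(0, j, o)], 1 ≤ p.2.1 ∧ p.2.1 ≤ 2 ^ r - 1) ↔
      ∀ p ∈ L, 1 ≤ p.2.1 ∧ p.2.1 ≤ 2 ^ r - 1 := by
    simp only [List.forall_mem_append, List.forall_mem_map, List.forall_mem_singleton, shift]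
    exact and_iff_left ⟨hj, hjr⟩
  have hbits : ∀ i : Fin r, (((L.map (shift s) ++ [(0, j, o)]).countP
        (fun p : CPart => p.2.1.testBit (i : ℕ)) : ℕ) : ℤ) = ℓ i ↔
      ((L.countP (fun p : CPart => p.2.1.testBit (i : ℕ)) : ℕ) : ℤ)
        = ℓ i - if j.testBit (i : ℕ) then 1 else 0 := by
    intro i
    simp only [List.countP_append, List.countP_map, List.countP_singleton, Function.comp_def, shift]
    split_ifs <;> push_cast <;> omega
  have hover : (((L.map (shift s) ++ [(0, j, o)]).countP (fun p : CPart => !p.2.2) : ℕ) : ℤ) = k ↔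
      ((L.countP (fun p : CPart => !p.2.2) : ℕ) : ℤ) = k - if o then 0 else 1 := by
    simp only [List.countP_append, List.countP_map, List.countP_singleton, Function.comp_def, shift]
    cases o <;> simp
    omega
  have hlen : (((L.map (shift s) ++ [(0, j, o)]).length : ℕ) : ℤ) = m ↔ (L.length : ℤ) = m - 1 := by
    simp
    omega
  have hsum : (L.length : ℤ) = m - 1 →
      (((((L.map (shift s) ++ [(0, j, o)]).map Prod.fst).sum : ℕ) : ℤ) = n ↔
        (((L.map Prod.fst).sum : ℕ) : ℤ) = n - (m - 1) * s) := by
    intro h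
    rw [List.map_append, List.sum_append, sum_map_shift, ← h]
    simp
    omega
  unfold Counted
  simp only [hchain, hcol, hrange, hbits, hover, hlen]
  constructor
  · rintro ⟨⟨h1, -⟩, h2, h3, h4, ⟨h5, h5'⟩, h6, h7, -⟩
    exact ⟨h1, h2, h3, h4, h5, h6, (hsum h6).1 h7, (hlast (fun p hp => (h2 p hp).1) h1.1).1 h5'⟩
  · rintro ⟨h1, h2, h3, h4, h5, h6, h7, h8⟩
    have hco := fun p hp => cOrder_shift_zero hj hs (h8 p hp)
    refine ⟨⟨h1, fun p hp => ⟨hco p hp, ?_⟩⟩, h2, h3, h4,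
      ⟨h5, (hlast (fun p hp => (h2 p hp).1) h1.1).2 h8⟩, h6, (hsum h6).2 h7, ?_⟩
    · rintro - rfl
      have := one_le_w hj
      simp only [chi, if_true] at hs
      omega
    · have hq : PartGE (0, j) (0, j) := Or.inr ⟨rfl, le_rfl⟩
      simp only [List.forall_mem_append, List.forall_mem_map, List.forall_mem_singleton]
      exact ⟨fun p hp => partGE_of_cOrder (hco p hp) hq, hq⟩

/-- If some part of a counted list is `0_(ũ_j)`, the list ends in `0_(ũ_j)`. -/
lemma exists_eq_snoc {r j : ℕ} (hj : 1 ≤ j) {ℓ : Fin r → ℤ} {k m n : ℤ} {M : List CPart}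
    (h : Counted r (0, j) ℓ k m n M) {p : CPart} (hp : p ∈ M) (hpj : (p.1, p.2.1) = (0, j)) :
    ∃ (o : Bool) (L : List CPart), M = L.map (shift (w j + chi o - 1)) ++ [(0, j, o)] := by
  obtain rfl | ⟨L, ⟨a, c, o⟩, rfl⟩ := M.eq_nil_or_concat'
  · simp at hp
  obtain ⟨h1, h2, -, -, h5, -, -, h8⟩ := h
  have hord := ((isColouredOverpartition_snoc_iff L (a, c, o)).1 h1).2
  have hq : a = 0 ∧ c = j := by
    have hge := h8 (a, c, o) (by simp)
    rcases List.mem_append.1 hp with hp | hp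
    · have := (hord p hp).1
      simp only [PartGE, COrder, Prod.mk.injEq] at *
      omega
    · rw [List.mem_singleton.1 hp] at hpj
      simpa using hpj
  obtain ⟨rfl, rfl⟩ := hq
  have hw := one_le_w hj
  obtain ⟨L', hL'⟩ := exists_map_shift (s := w c + chi o - 1) (L := L) <| by
    have hc : List.IsChain COrder L := ((isColouredOverpartition_snoc_iff L _).1 h1).1.1
    have := partGE_of_getLast hc (b := (w c + chi o - 1, 0)) <| by
      intro p hp
      have hd := (List.isChain_append.1 h5).2.2 p hp (0, c, o) (by simp)
      simp only [DiffCond, PartGE] at *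
      omega
    intro p hp
    have := this p hp
    simp only [PartGE] at this
    omega
  exact ⟨o, L', by rw [← hL']⟩

/-- Removing the smallest part `0_(ũ_j)`; here `b` is the successor of `0_(ũ_j)`. -/
lemma pcount_eq_add {r j : ℕ} (hj : 1 ≤ j) (hjr : j ≤ 2 ^ r - 1) (ℓ : Fin r → ℤ) (k m n : ℤ)
    {b : ℕ × ℕ} (hb : ∀ x : ℕ × ℕ, 1 ≤ x.2 → x.2 ≤ 2 ^ r - 1 →
      (PartGE x b ↔ PartGE x (0, j) ∧ x ≠ (0, j))) :
    pcount r (0, j) ℓ k m n = pcount r b ℓ k m n +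
      (pcount r (0, 2 ^ v j) (fun i => ℓ i - if j.testBit (i : ℕ) then 1 else 0)
          k (m - 1) (n - (m - 1) * w j) +
        pcount r (0, 2 ^ v j) (fun i => ℓ i - if j.testBit (i : ℕ) then 1 else 0)
          (k - 1) (m - 1) (n - (m - 1) * ((w j : ℤ) - 1))) := by
  have hw := one_le_w hj
  let f (o : Bool) (L : List CPart) : List CPart :=
    L.map (shift (w j + chi o - 1)) ++ [(0, j, o)]
  have hf : ∀ o, Function.Injective (f o) := fun o =>
    (List.append_left_injective _).comp (List.map_injective_iff.2 (shift_injective _))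
  have hfm : ∀ o L, Counted r (0, j) ℓ k m n (f o L) ↔ _ := fun o L =>
    counted_snoc_iff hj hjr ℓ k m n o (by omega) L
  let A (o : Bool) : Set (List CPart) := {L | Counted r (0, j) ℓ k m n (f o L)}
  have hAt : A true = {L | Counted r (0, 2 ^ v j)
      (fun i => ℓ i - if j.testBit (i : ℕ) then 1 else 0) k (m - 1) (n - (m - 1) * w j) L} := by
    ext L
    simp [A, hfm, chi]
  have hAf : A false = {L | Counted r (0, 2 ^ v j)
      (fun i => ℓ i - if j.testBit (i : ℕ) then 1 else 0) (k - 1) (m - 1)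
        (n - (m - 1) * ((w j : ℤ) - 1)) L} := by
    ext L
    simp [A, hfm, chi, Nat.cast_sub hw]
  have hlast : ∀ o L, (0, j, o) ∈ f o L := fun o L => by simp [f]
  have hunion : {L | Counted r (0, j) ℓ k m n L} =
      {L | Counted r b ℓ k m n L} ∪ (f true '' A true ∪ f false '' A false) := by
    ext M
    constructor
    · intro hM
      by_cases h : ∃ p ∈ M, (p.1, p.2.1) = (0, j)
      · obtain ⟨p, hp, hpj⟩ := h
        obtain ⟨o, L, rfl⟩ := exists_eq_snoc hj hM hp hpj
        right
        cases o
        · exact Or.inr ⟨L, hM, rfl⟩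
        · exact Or.inl ⟨L, hM, rfl⟩
      · push Not at h
        obtain ⟨h1, h2, h3, h4, h5, h6, h7, h8⟩ := hM
        exact Or.inl ⟨h1, h2, h3, h4, h5, h6, h7, fun p hp =>
          (hb (p.1, p.2.1) (h2 p hp).1 (h2 p hp).2).2 ⟨h8 p hp, h p hp⟩⟩
    · rintro (⟨h1, h2, h3, h4, h5, h6, h7, h8⟩ | ⟨L, hL, rfl⟩ | ⟨L, hL, rfl⟩)
      · exact ⟨h1, h2, h3, h4, h5, h6, h7, fun p hp =>
          ((hb (p.1, p.2.1) (h2 p hp).1 (h2 p hp).2).1 (h8 p hp)).1⟩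
      · exact hL
      · exact hL
  have hfin := finite_counted r (0, j) ℓ k m n
  have hsub := hunion.symm.subset
  rw [Set.union_subset_iff, Set.union_subset_iff] at hsub
  have hd1 : Disjoint (f true '' A true) (f false '' A false) := by
    rw [Set.disjoint_left]
    rintro _ ⟨L, -, rfl⟩ ⟨L', -, h⟩
    have := congrArg List.getLast? h
    simp [f] at this
  have hd2 : Disjoint {L | Counted r b ℓ k m n L} (f true '' A true ∪ f false '' A false) := by
    rw [Set.disjoint_left]
    have key : ∀ o L, ¬ Counted r b ℓ k m n (f o L) := fun o L h =>
      ((hb (0, j) hj hjr).1 (h.2.2.2.2.2.2.2 _ (hlast o L))).2 rfl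
    rintro _ h (⟨L, -, rfl⟩ | ⟨L, -, rfl⟩)
    · exact key _ _ h
    · exact key _ _ h
  simp only [pcount_eq_ncard]
  rw [hunion, Set.ncard_union_eq hd2 (hfin.subset hsub.1)
      ((hfin.subset hsub.2.1).union (hfin.subset hsub.2.2)),
    Set.ncard_union_eq hd1 (hfin.subset hsub.2.1) (hfin.subset hsub.2.2),
    Set.ncard_image_of_injective _ (hf _), Set.ncard_image_of_injective _ (hf _), hAt, hAf]

lemma pcount_one_one (r : ℕ) (ℓ : Fin r → ℤ) (k m n : ℤ) :
    pcount r (1, 1) ℓ k m n = pcount r (0, 1) ℓ k m (n - m) := by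
  have hinj : Function.Injective (List.map (shift 1)) :=
    List.map_injective_iff.2 (shift_injective 1)
  have hiff : ∀ L : List CPart, Counted r (1, 1) ℓ k m n (L.map (shift 1)) ↔
      Counted r (0, 1) ℓ k m (n - m) L := by
    intro L
    have hsum : (L.length : ℤ) = m →
        (((((L.map (shift 1)).map Prod.fst).sum : ℕ) : ℤ) = n ↔
          (((L.map Prod.fst).sum : ℕ) : ℤ) = n - m) := by
      intro h
      rw [sum_map_shift, ← h]
      push_cast
      omega
    have hge : ∀ p : CPart, PartGE ((shift 1 p).1, (shift 1 p).2.1) (1, 1) ↔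
        PartGE (p.1, p.2.1) (0, 1) := by
      simp [PartGE, shift]
    simp only [Counted, isColouredOverpartition_map_shift, isChain_diffCond_map_shift,
      List.forall_mem_map, List.countP_map, List.length_map, hge]
    have h2 : ∀ p : CPart, (shift 1 p).2 = p.2 := fun _ => rfl
    simp only [Function.comp_def, h2]
    tauto
  have himage : {L | Counted r (1, 1) ℓ k m n L} =
      List.map (shift 1) '' {L | Counted r (0, 1) ℓ k m (n - m) L} := by
    ext M
    constructor
    · intro hM
      obtain ⟨L, rfl⟩ := exists_map_shift (s := 1) (L := M) <| by
        intro p hp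
        have := hM.2.2.2.2.2.2.2 p hp
        simp only [PartGE] at this
        omega
      exact ⟨L, (hiff L).1 hM, rfl⟩
    · rintro ⟨L, hL, rfl⟩
      exact (hiff L).2 hL
  rw [pcount_eq_ncard, pcount_eq_ncard, himage, Set.ncard_image_of_injective _ hinj]

/-- Lemma `lemma1`. -/
theorem statement9 (r : ℕ) (hr : 1 ≤ r) (ℓ : Fin r → ℕ) (k m n : ℕ) :
    (∀ j : ℕ, 1 ≤ j → j ≤ 2 ^ r - 2 →
      (pcount r (0, j) (fun i => (ℓ i : ℤ)) k m n : ℤ)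
          - (pcount r (0, j + 1) (fun i => (ℓ i : ℤ)) k m n : ℤ)
        = (pcount r (0, 2 ^ v j) (fun i => (ℓ i : ℤ) - if j.testBit (i : ℕ) then 1 else 0)
            k ((m : ℤ) - 1) ((n : ℤ) - ((m : ℤ) - 1) * w j) : ℤ)
          + (pcount r (0, 2 ^ v j) (fun i => (ℓ i : ℤ) - if j.testBit (i : ℕ) then 1 else 0)
            ((k : ℤ) - 1) ((m : ℤ) - 1) ((n : ℤ) - ((m : ℤ) - 1) * ((w j : ℤ) - 1)) : ℤ)) ∧
    ((pcount r (0, 2 ^ r - 1) (fun i => (ℓ i : ℤ)) k m n : ℤ)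
          - (pcount r (1, 1) (fun i => (ℓ i : ℤ)) k m n : ℤ)
        = (pcount r (0, 1) (fun i => (ℓ i : ℤ) - 1)
            k ((m : ℤ) - 1) ((n : ℤ) - ((m : ℤ) - 1) * r) : ℤ)
          + (pcount r (0, 1) (fun i => (ℓ i : ℤ) - 1)
            ((k : ℤ) - 1) ((m : ℤ) - 1) ((n : ℤ) - ((m : ℤ) - 1) * ((r : ℤ) - 1)) : ℤ)) ∧
    pcount r (1, 1) (fun i => (ℓ i : ℤ)) k m n
      = pcount r (0, 1) (fun i => (ℓ i : ℤ)) k m ((n : ℤ) - m) := by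
  refine ⟨fun j hj hjr => ?_, ?_, ?_⟩
  · rw [pcount_eq_add hj (by omega) _ _ _ _ (b := (0, j + 1))]
    · push_cast
      ring
    · rintro ⟨a, c⟩ - -
      simp only [PartGE, Prod.mk.injEq, ne_eq]
      omega
  · have h2 : 1 ≤ 2 ^ r - 1 := by
      have := Nat.pow_le_pow_right (n := 2) (by norm_num) hr
      omega
    rw [pcount_eq_add h2 le_rfl _ _ _ _ (b := (1, 1))]
    · have hbit : ∀ i : Fin r, (2 ^ r - 1).testBit (i : ℕ) = true := by
        simp [Nat.testBit_two_pow_sub_one]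
      simp only [v_two_pow_sub_one hr, w_two_pow_sub_one, hbit, pow_zero, if_true]
      push_cast
      ring
    · rintro ⟨a, c⟩ h h'
      simp only [PartGE, Prod.mk.injEq, ne_eq] at *
      omega
  · exact pcount_one_one r _ _ _ _

end Stmt9
end
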